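/- arXiv:2203.05690 — 2 statements merged into one kernel-verified Lean document; each statement's English description precedes it below -/
import Mathlib

section
/- For all natural numbers n and m, the following identities of formal power series in z and q hold: ∑_{k=0}^{n} z^k q^{k²} [n choose k]_q / (zq;q)_{m+k} = ∑_{k=0}^{m} z^k q^{k²} [m choose k]_q / (zq;q)_{n+k} = (1/(zq;q)_{n+m}) · ∑_{i=0}^{m} (−z)^i q^{in + i(i+1)/2} [m choose i]_q ∑_{k=0}^{m−i} z^k q^{k(k+i)} [m−i choose k]_q. -/
noncomputable section

/-- The ring of formal power series `ℚ[[z,q]]`. -/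
abbrev R2 : Type := MvPowerSeries (Fin 2) ℚ

/-- The variable `z`. -/
def Z : R2 := MvPowerSeries.X 0
/-- The variable `q`. -/
def Q : R2 := MvPowerSeries.X 1

/-- The q-Pochhammer symbol `(a;q)_n = ∏_{t=0}^{n-1} (1 - a q^t)`. -/
def poch (a : R2) (n : ℕ) : R2 := ∏ t ∈ Finset.range n, (1 - a * Q ^ t)

/-- `(q;q)_n`. -/
def qp (n : ℕ) : R2 := poch Q n

/-- The Gaussian binomial coefficient `[n choose k]_q = (q;q)_n / ((q;q)_k (q;q)_{n-k})`
for `0 ≤ k ≤ n`, and `0` otherwise. -/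
def gbinom (n k : ℕ) : R2 := if k ≤ n then qp n * (qp k * qp (n - k))⁻¹ else 0

/-- The sum `∑_{k=0}^{n} a^k q^{k²} [n choose k]_q / (aq;q)_{m+k}`. -/
def durfeeSum (a : R2) (n m : ℕ) : R2 :=
  ∑ k ∈ Finset.range (n + 1), a ^ k * Q ^ (k ^ 2) * gbinom n k * (poch (a * Q) (m + k))⁻¹

lemma poch_zero (a : R2) : poch a 0 = 1 := by simp [poch]

lemma poch_succ (a : R2) (n : ℕ) : poch a (n + 1) = poch a n * (1 - a * Q ^ n) := by
  simp [poch, Finset.prod_range_succ]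

lemma poch_succ' (a : R2) (n : ℕ) : poch a (n + 1) = (1 - a) * poch (a * Q) n := by
  simp only [poch, Finset.prod_range_succ', pow_zero, mul_one]
  rw [mul_comm]
  congr 1
  exact Finset.prod_congr rfl fun t _ => by ring

lemma poch_add (a : R2) (n m : ℕ) : poch a (n + m) = poch a n * poch (a * Q ^ n) m := by
  simp only [poch, Finset.prod_range_add]
  congr 1
  exact Finset.prod_congr rfl fun t _ => by ring

lemma constantCoeff_Q : MvPowerSeries.constantCoeff Q = 0 :=
  MvPowerSeries.constantCoeff_X 1

lemma constantCoeff_poch_mul_Q (a : R2) (n : ℕ) :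
    MvPowerSeries.constantCoeff (poch (a * Q) n) = 1 := by
  simp [poch, constantCoeff_Q]

lemma poch_mul_Q_mul_inv (a : R2) (n : ℕ) : poch (a * Q) n * (poch (a * Q) n)⁻¹ = 1 :=
  MvPowerSeries.mul_inv_cancel _ (by simp [constantCoeff_poch_mul_Q])

lemma one_sub_mul_inv (a : R2) : (1 - a * Q) * (1 - a * Q)⁻¹ = 1 :=
  MvPowerSeries.mul_inv_cancel _ (by simp [constantCoeff_Q])

lemma poch_inv_succ' (a : R2) (n : ℕ) :
    (poch (a * Q) (n + 1))⁻¹ = (1 - a * Q)⁻¹ * (poch (a * Q * Q) n)⁻¹ := by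
  rw [poch_succ', MvPowerSeries.mul_inv_rev, mul_comm]

lemma poch_inv_succ (a : R2) (n : ℕ) :
    (poch (a * Q) (n + 1))⁻¹
      = (poch (a * Q) n)⁻¹ + a * Q ^ (n + 1) * (poch (a * Q) (n + 1))⁻¹ := by
  have h := poch_mul_Q_mul_inv a n
  have h' := poch_mul_Q_mul_inv a (n + 1)
  rw [poch_succ] at h' ⊢
  generalize (poch (a * Q) n * (1 - a * Q * Q ^ n))⁻¹ = y at *
  generalize (poch (a * Q) n)⁻¹ = x at *
  linear_combination x * h' - y * (1 - a * Q * Q ^ n) * h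

lemma qp_zero : qp 0 = 1 := poch_zero Q

lemma qp_succ (n : ℕ) : qp (n + 1) = qp n * (1 - Q ^ (n + 1)) := by
  rw [qp, poch_succ, ← pow_succ']; rfl

lemma constantCoeff_qp (n : ℕ) : MvPowerSeries.constantCoeff (qp n) = 1 := by
  simpa [qp] using constantCoeff_poch_mul_Q 1 n

lemma qp_ne_zero (n : ℕ) : qp n ≠ 0 := fun h => by
  simpa [h] using constantCoeff_qp n

lemma gbinom_add_mul (k d : ℕ) : gbinom (k + d) k * (qp k * qp d) = qp (k + d) := by
  rw [gbinom, if_pos (Nat.le_add_right k d), Nat.add_sub_cancel_left, mul_assoc,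
    MvPowerSeries.inv_mul_cancel _ (by simp [constantCoeff_qp]), mul_one]

lemma gbinom_of_lt {n k : ℕ} (h : n < k) : gbinom n k = 0 := if_neg (not_le.mpr h)

lemma gbinom_self (n : ℕ) : gbinom n n = 1 := by
  have h := gbinom_add_mul n 0
  rw [qp_zero, mul_one, add_zero] at h
  exact mul_right_cancel₀ (qp_ne_zero n) (h.trans (one_mul _).symm)

lemma gbinom_zero_right (n : ℕ) : gbinom n 0 = 1 := by
  have h := gbinom_add_mul 0 n
  rw [qp_zero, one_mul, zero_add] at h
  exact mul_right_cancel₀ (qp_ne_zero n) (h.trans (one_mul _).symm)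

/-- The `q`-Pascal recurrence. -/
lemma gbinom_succ_succ {n k : ℕ} (h : k ≤ n) :
    gbinom (n + 1) (k + 1) = gbinom n (k + 1) + Q ^ (n - k) * gbinom n k := by
  obtain rfl | h := h.eq_or_lt
  · simp [gbinom_self, gbinom_of_lt]
  obtain ⟨d, rfl⟩ := Nat.exists_eq_add_of_lt h
  have h₁ := gbinom_add_mul (k + 1) (d + 1)
  have h₂ := gbinom_add_mul (k + 1) d
  have h₃ := gbinom_add_mul k (d + 1)
  rw [show k + 1 + (d + 1) = k + d + 1 + 1 by ring, qp_succ (k + d + 1)] at h₁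
  rw [show k + 1 + d = k + d + 1 by ring] at h₂
  rw [← add_assoc] at h₃
  rw [show k + d + 1 - k = d + 1 by lia]
  refine mul_right_cancel₀ (mul_ne_zero (qp_ne_zero (k + 1)) (qp_ne_zero (d + 1))) ?_
  rw [h₁]
  rw [qp_succ d] at *
  rw [qp_succ k] at *
  linear_combination (-(1 - Q ^ (d + 1))) * h₂ - Q ^ (d + 1) * (1 - Q ^ (k + 1)) * h₃

lemma gbinom_mul_gbinom (k i d : ℕ) :
    gbinom (k + i + d) k * gbinom (i + d) i = gbinom (k + i + d) i * gbinom (k + d) k := by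
  have h₁ := gbinom_add_mul k (i + d)
  have h₂ := gbinom_add_mul i d
  have h₃ := gbinom_add_mul i (k + d)
  have h₄ := gbinom_add_mul k d
  rw [← add_assoc] at h₁
  rw [show i + (k + d) = k + i + d by ring] at h₃
  refine mul_right_cancel₀
    (mul_ne_zero (qp_ne_zero k) (mul_ne_zero (qp_ne_zero i) (qp_ne_zero d))) ?_
  linear_combination gbinom (k + i + d) k * qp k * h₂ + h₁
    - gbinom (k + i + d) i * qp i * h₄ - h₃

/-- The `q`-binomial theorem. -/
lemma poch_eq_sum (a : R2) (n : ℕ) :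
    poch a n = ∑ i ∈ Finset.range (n + 1), (-a) ^ i * Q ^ (i.choose 2) * gbinom n i := by
  induction n with
  | zero => simp [poch_zero, gbinom_self]
  | succ n ih =>
    have e : poch a n =
        ∑ i ∈ Finset.range (n + 2), (-a) ^ i * Q ^ (i.choose 2) * gbinom n i := by
      rw [Finset.sum_range_succ, ← ih, gbinom_of_lt n.lt_succ_self, mul_zero, add_zero]
    rw [poch_succ, mul_sub, mul_one]
    nth_rewrite 1 [e]
    rw [ih, Finset.sum_range_succ', Finset.sum_range_succ' _ (n + 1), gbinom_zero_right,
      gbinom_zero_right, add_sub_right_comm, Finset.sum_mul, ← Finset.sum_sub_distrib]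
    congr 1
    refine Finset.sum_congr rfl fun i hi => ?_
    obtain ⟨d, rfl⟩ := Nat.exists_eq_add_of_le (Finset.mem_range_succ_iff.mp hi)
    rw [gbinom_succ_succ (Nat.le_add_right i d), Nat.add_sub_cancel_left,
      Nat.choose_succ_succ' i 1, Nat.choose_one_right]
    ring

lemma durfeeSum_succ_left (a : R2) (n m : ℕ) :
    durfeeSum a (n + 1) m
      = durfeeSum a n m + a * Q ^ (n + 1) * (1 - a * Q)⁻¹ * durfeeSum (a * Q) n m := by
  have e : durfeeSum a n m = ∑ k ∈ Finset.range (n + 2),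
      a ^ k * Q ^ (k ^ 2) * gbinom n k * (poch (a * Q) (m + k))⁻¹ := by
    rw [Finset.sum_range_succ, gbinom_of_lt n.lt_succ_self, mul_zero, zero_mul, add_zero,
      durfeeSum]
  rw [e, durfeeSum, durfeeSum, Finset.sum_range_succ', Finset.sum_range_succ' _ (n + 1),
    gbinom_zero_right, gbinom_zero_right, add_right_comm, Finset.mul_sum,
    ← Finset.sum_add_distrib]
  congr 1
  refine Finset.sum_congr rfl fun k hk => ?_
  obtain ⟨d, rfl⟩ := Nat.exists_eq_add_of_le (Finset.mem_range_succ_iff.mp hk)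
  rw [gbinom_succ_succ (Nat.le_add_right k d), Nat.add_sub_cancel_left, ← add_assoc,
    poch_inv_succ']
  ring

lemma durfeeSum_succ_right (a : R2) (n m : ℕ) :
    durfeeSum a m (n + 1)
      = durfeeSum a m n + a * Q ^ (n + 1) * (1 - a * Q)⁻¹ * durfeeSum (a * Q) m n := by
  simp only [durfeeSum]
  rw [Finset.mul_sum, ← Finset.sum_add_distrib]
  refine Finset.sum_congr rfl fun k _ => ?_
  rw [add_right_comm, poch_inv_succ, poch_inv_succ']
  ring

lemma durfeeSum_zero_left (a : R2) (m : ℕ) : durfeeSum a 0 m = (poch (a * Q) m)⁻¹ := by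
  simp [durfeeSum, gbinom_self]

lemma durfeeSum_zero_right (a : R2) (n : ℕ) : durfeeSum a n 0 = (poch (a * Q) n)⁻¹ := by
  induction n generalizing a with
  | zero => exact durfeeSum_zero_left a 0
  | succ n ih =>
    rw [durfeeSum_succ_left, ih, ih, poch_inv_succ, poch_inv_succ']
    ring

lemma durfeeSum_comm (a : R2) (n m : ℕ) : durfeeSum a n m = durfeeSum a m n := by
  induction n generalizing a with
  | zero => rw [durfeeSum_zero_left, durfeeSum_zero_right]
  | succ n ih => rw [durfeeSum_succ_left, durfeeSum_succ_right, ih, ih]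

lemma durfeeSum_eq (a : R2) (n m : ℕ) :
    durfeeSum a m n = (poch (a * Q) (n + m))⁻¹ *
      ∑ i ∈ Finset.range (m + 1),
        (-a) ^ i * Q ^ (i * n + Nat.choose (i + 1) 2) * gbinom m i *
          ∑ k ∈ Finset.range (m - i + 1), a ^ k * Q ^ (k * (k + i)) * gbinom (m - i) k := by
  have expand : ∀ k ∈ Finset.range (m + 1),
      a ^ k * Q ^ (k ^ 2) * gbinom m k * (poch (a * Q) (n + k))⁻¹
        = ∑ i ∈ Finset.range (m - k + 1), (poch (a * Q) (n + m))⁻¹ *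
          ((-a) ^ i * Q ^ (i * n + Nat.choose (i + 1) 2) * gbinom m i *
            (a ^ k * Q ^ (k * (k + i)) * gbinom (m - i) k)) := by
    intro k hk
    obtain ⟨d, rfl⟩ := Nat.exists_eq_add_of_le (Finset.mem_range_succ_iff.mp hk)
    have hinv : (poch (a * Q) (n + k))⁻¹
        = (poch (a * Q) (n + (k + d)))⁻¹ * poch (a * Q * Q ^ (n + k)) d := by
      have h₁ := poch_mul_Q_mul_inv a (n + k)
      have h₂ := poch_mul_Q_mul_inv a (n + (k + d))
      rw [← add_assoc, poch_add _ (n + k) d] at h₂ ⊢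
      generalize (poch (a * Q) (n + k) * poch (a * Q * Q ^ (n + k)) d)⁻¹ = y at *
      generalize (poch (a * Q) (n + k))⁻¹ = x at *
      linear_combination y * poch (a * Q * Q ^ (n + k)) d * h₁ - x * h₂
    rw [hinv, poch_eq_sum _ d, Nat.add_sub_cancel_left, Finset.mul_sum, Finset.mul_sum]
    refine Finset.sum_congr rfl fun i hi => ?_
    obtain ⟨e, rfl⟩ := Nat.exists_eq_add_of_le (Finset.mem_range_succ_iff.mp hi)
    have h := gbinom_mul_gbinom k i e
    rw [add_assoc] at h
    rw [show k + (i + e) - i = k + e by lia, Nat.choose_succ_succ' i 1, Nat.choose_one_right]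
    linear_combination a ^ k * Q ^ (k ^ 2) * (poch (a * Q) (n + (k + (i + e))))⁻¹ *
      (-(a * Q * Q ^ (n + k))) ^ i * Q ^ (i.choose 2) * h
  rw [durfeeSum, Finset.sum_congr rfl expand, Finset.mul_sum]
  simp only [Finset.mul_sum]
  refine Finset.sum_comm' fun k i => ?_
  simp only [Finset.mem_range]
  lia

/-- Warnaar's lemma (`lem:war_gen`): for all `n m`,
`∑_{k=0}^{n} z^k q^{k²} [n choose k]_q / (zq;q)_{m+k}
  = ∑_{k=0}^{m} z^k q^{k²} [m choose k]_q / (zq;q)_{n+k}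
  = (1/(zq;q)_{n+m}) ∑_{i=0}^{m} (−z)^i q^{in + binom(i+1,2)} [m choose i]_q
       ∑_{k=0}^{m−i} z^k q^{k(k+i)} [m−i choose k]_q`. -/
theorem statement1 (n m : ℕ) :
    (∑ k ∈ Finset.range (n + 1),
        Z ^ k * Q ^ (k ^ 2) * gbinom n k * (poch (Z * Q) (m + k))⁻¹)
      = (∑ k ∈ Finset.range (m + 1),
        Z ^ k * Q ^ (k ^ 2) * gbinom m k * (poch (Z * Q) (n + k))⁻¹) ∧
    (∑ k ∈ Finset.range (m + 1),
        Z ^ k * Q ^ (k ^ 2) * gbinom m k * (poch (Z * Q) (n + k))⁻¹)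
      = (poch (Z * Q) (n + m))⁻¹ *
          ∑ i ∈ Finset.range (m + 1),
            (-Z) ^ i * Q ^ (i * n + Nat.choose (i + 1) 2) * gbinom m i *
              ∑ k ∈ Finset.range (m - i + 1),
                Z ^ k * Q ^ (k * (k + i)) * gbinom (m - i) k := by
  exact ⟨durfeeSum_comm Z n m, durfeeSum_eq Z n m⟩
end
end

section
/- Fix k ≥ 1. For 1 ≤ t ≤ k+1 define the formal power series X(k,t) = ∑_{n₁ ≥ n₂ ≥ ⋯ ≥ n_k ≥ 0} q^{n₁²+⋯+n_k² + n_t + n_{t+1} + ⋯ + n_k} / ((q)_{n₁−n₂} (q)_{n₂−n₃} ⋯ (q)_{n_{k−1}−n_k} (q)_{n_k} (q²;q)_{n_k}), the sum being over all weakly decreasing chains n₁ ≥ ⋯ ≥ n_k ≥ 0 of natural numbers (this sum converges coefficientwise). Then for every t with 1 ≤ t ≤ k: X(k,1) = X(k,t+1) − q·X(k,t) = 1/(q²;q)_∞. -/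
noncomputable section

open PowerSeries

/-- The coefficientwise (product) topology on `ℚ[[q]]`. -/
instance : TopologicalSpace (PowerSeries ℚ) :=
  inferInstanceAs (TopologicalSpace ((Unit →₀ ℕ) → ℚ))

/-- The q-Pochhammer symbol `(q^j;q)_n = ∏_{t=0}^{n-1} (1 - q^{j+t})` in `ℚ[[q]]`. -/
def pochN (j n : ℕ) : PowerSeries ℚ :=
  ∏ t ∈ Finset.range n, (1 - (X : PowerSeries ℚ) ^ (j + t))

/-- `X k t = ∑_{n₁ ≥ n₂ ≥ ⋯ ≥ n_k ≥ 0}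
q^{n₁²+⋯+n_k² + n_t + n_{t+1} + ⋯ + n_k} /
((q)_{n₁−n₂} (q)_{n₂−n₃} ⋯ (q)_{n_{k−1}−n_k} (q)_{n_k} (q²;q)_{n_k})`,
the sum being over all weakly decreasing tuples `(n₁,…,n_k)` of natural numbers.
(Here `n_i` is encoded as `nn (i-1)`.) -/
def Xser (k t : ℕ) : PowerSeries ℚ :=
  ∑' f : {g : Fin k → ℕ // ∀ i j : Fin k, i ≤ j → g j ≤ g i},
    (fun nn : ℕ → ℕ =>
      (X : PowerSeries ℚ) ^
          ((∑ j ∈ Finset.range k, (nn j) ^ 2) +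
            ∑ j ∈ Finset.range k, if t ≤ j + 1 then nn j else 0) *
        ((∏ j ∈ Finset.range (k - 1), pochN 1 (nn j - nn (j + 1))) *
            pochN 1 (nn (k - 1)) * pochN 2 (nn (k - 1)))⁻¹)
    (fun j => if h : j < k then f.1 ⟨j, h⟩ else 0)

theorem constantCoeff_pochN {j : ℕ} (hj : j ≠ 0) (n : ℕ) :
    constantCoeff (pochN j n) = 1 := by
  simp [pochN, map_prod, hj]

theorem pochN_mul_inv {j : ℕ} (hj : j ≠ 0) (n : ℕ) : pochN j n * (pochN j n)⁻¹ = 1 :=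
  PowerSeries.mul_inv_cancel _ (by simp [constantCoeff_pochN hj])

theorem pochN_succ (j n : ℕ) : pochN j (n + 1) = pochN j n * (1 - X ^ (j + n)) :=
  Finset.prod_range_succ _ _

theorem pochN_one_succ (n : ℕ) : pochN 1 (n + 1) = (1 - X) * pochN 2 n := by
  rw [pochN, Finset.prod_range_succ', mul_comm, pochN]
  congr 1
  · simp
  · exact Finset.prod_congr rfl fun t _ => by congr 2; omega

theorem one_sub_mul_inv_pochN_succ (n : ℕ) : (1 - X ^ (n + 1)) * (pochN 1 (n + 1))⁻¹ = (pochN 1 n)⁻¹ := by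
  have h := pochN_mul_inv one_ne_zero n
  have h' := pochN_mul_inv one_ne_zero (n + 1)
  rw [pochN_succ, add_comm 1 n] at *
  linear_combination (pochN 1 n)⁻¹ * h' - (1 - X ^ (n + 1)) * (pochN 1 n * (1 - X ^ (n + 1)))⁻¹ * h

theorem inv_pochN_two (n : ℕ) : (pochN 2 n)⁻¹ = (1 - X) * (pochN 1 (n + 1))⁻¹ := by
  have h := pochN_mul_inv two_ne_zero n
  have h' := pochN_mul_inv one_ne_zero (n + 1)
  have e := pochN_one_succ n
  linear_combination (-(pochN 2 n)⁻¹) * h' + (pochN 2 n)⁻¹ * (pochN 1 (n + 1))⁻¹ * e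
    + (1 - X) * (pochN 1 (n + 1))⁻¹ * h

/-- The limiting case of the `q`-Vandermonde summation. -/
theorem sum_inv_pochN (n : ℕ) : ∀ a : ℕ,
    ∑ r ∈ Finset.range (n + 1), X ^ (r ^ 2 + a * r) * (pochN 1 (n - r))⁻¹ * (pochN 1 r)⁻¹ * (pochN 1 (r + a))⁻¹ =
      (pochN 1 n)⁻¹ * (pochN 1 (n + a))⁻¹ := by
  induction n with
  | zero => intro a; simp [pochN]
  | succ n ih =>
    intro a
    have hne : (1 - X ^ (n + 1) : PowerSeries ℚ) ≠ 0 := fun h => by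
      simpa using congrArg (constantCoeff (R := ℚ)) h
    apply mul_left_cancel₀ hne
    have key : (1 - X ^ (n + 1)) * ∑ r ∈ Finset.range (n + 1 + 1),
        X ^ (r ^ 2 + a * r) * (pochN 1 (n + 1 - r))⁻¹ * (pochN 1 r)⁻¹ * (pochN 1 (r + a))⁻¹ =
        ∑ r ∈ Finset.range (n + 1),
          X ^ (r ^ 2 + (a + 1) * r) * (pochN 1 (n - r))⁻¹ * (pochN 1 r)⁻¹ * (pochN 1 (r + (a + 1)))⁻¹ := by
      have split : (1 - X ^ (n + 1)) * ∑ r ∈ Finset.range (n + 1 + 1),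
          X ^ (r ^ 2 + a * r) * (pochN 1 (n + 1 - r))⁻¹ * (pochN 1 r)⁻¹ * (pochN 1 (r + a))⁻¹ =
          ∑ r ∈ Finset.range (n + 1 + 1), X ^ (r ^ 2 + a * r) * X ^ r *
            ((1 - X ^ (n + 1 - r)) * (pochN 1 (n + 1 - r))⁻¹) * (pochN 1 r)⁻¹ * (pochN 1 (r + a))⁻¹ +
          ∑ r ∈ Finset.range (n + 1 + 1), X ^ (r ^ 2 + a * r) * (pochN 1 (n + 1 - r))⁻¹ *
            ((1 - X ^ r) * (pochN 1 r)⁻¹) * (pochN 1 (r + a))⁻¹ := by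
        rw [Finset.mul_sum, ← Finset.sum_add_distrib]
        refine Finset.sum_congr rfl fun r hr => ?_
        have : (X : PowerSeries ℚ) ^ (n + 1) = X ^ r * X ^ (n + 1 - r) := by
          rw [← pow_add]; congr 1; have := Finset.mem_range.1 hr; omega
        rw [this]; ring
      rw [split, Finset.sum_range_succ, Finset.sum_range_succ' _ (n + 1)]
      simp only [Nat.sub_self, pow_zero, sub_self, zero_mul, mul_zero, add_zero]
      rw [← Finset.sum_add_distrib]
      refine Finset.sum_congr rfl fun r hr => ?_
      have hr' := Finset.mem_range.1 hr
      rw [show n + 1 - r = n - r + 1 by omega, show n + 1 - (r + 1) = n - r by omega,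
        one_sub_mul_inv_pochN_succ, one_sub_mul_inv_pochN_succ,
        ← one_sub_mul_inv_pochN_succ (r + a), show r + 1 + a = r + a + 1 by ring,
        show r + (a + 1) = r + a + 1 by ring]
      ring
    rw [key, ih (a + 1), ← one_sub_mul_inv_pochN_succ n, show n + 1 + a = n + (a + 1) by ring]
    ring

/-- The contribution of `c 0 ≥ c 1 ≥ ⋯ ≥ c k` to `boundedSum k t (c 0)`. -/
def chainTerm (k t : ℕ) (c : ℕ → ℕ) : PowerSeries ℚ :=
  X ^ ((∑ j ∈ Finset.range k, (c (j + 1)) ^ 2) +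
      ∑ j ∈ Finset.range k, if t ≤ j + 1 then c (j + 1) else 0) *
    ((∏ j ∈ Finset.range k, pochN 1 (c j - c (j + 1))) * pochN 1 (c k) * pochN 2 (c k))⁻¹

/-- The exponent contributed by the first entry of a chain. -/
def headExp (t n : ℕ) : ℕ := n ^ 2 + if t ≤ 1 then n else 0

theorem chainTerm_succ (k t : ℕ) (c : ℕ → ℕ) :
    chainTerm (k + 1) t c = X ^ headExp t (c 1) * (pochN 1 (c 0 - c 1))⁻¹ *
      chainTerm k (t - 1) (fun j => c (j + 1)) := by
  have h : ∀ j, (t ≤ j + 1 + 1) = (t - 1 ≤ j + 1) := fun j => by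
    rw [eq_iff_iff]; omega
  simp only [chainTerm, headExp, Finset.sum_range_succ', Finset.prod_range_succ',
    PowerSeries.mul_inv_rev, pow_add, h, zero_add]
  ring

/-- The sum of `chainTerm k t` over the chains `N = c 0 ≥ c 1 ≥ ⋯ ≥ c k ≥ 0`, as an iterated
sum. -/
def boundedSum : ℕ → ℕ → ℕ → PowerSeries ℚ
  | 0, _, N => (pochN 1 N)⁻¹ * (pochN 2 N)⁻¹
  | k + 1, t, N => ∑ n ∈ Finset.range (N + 1),
      X ^ headExp t n * (pochN 1 (N - n))⁻¹ * boundedSum k (t - 1) n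

theorem boundedSum_of_le_one (k : ℕ) : ∀ {t : ℕ}, t ≤ 1 → ∀ N,
    boundedSum k t N = (pochN 1 N)⁻¹ * (pochN 2 N)⁻¹ := by
  induction k with
  | zero => intro t _ N; rfl
  | succ k ih =>
    intro t ht N
    have h := sum_inv_pochN N 1
    rw [boundedSum, inv_pochN_two, mul_left_comm, ← h, Finset.mul_sum]
    refine Finset.sum_congr rfl fun n _ => ?_
    rw [ih (by omega), headExp, if_pos ht, inv_pochN_two, one_mul]
    ring

theorem boundedSum_succ_sub (k : ℕ) : ∀ {t : ℕ}, 1 ≤ t → t ≤ k → ∀ N,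
    boundedSum k (t + 1) N - X * boundedSum k t N = (1 - X) * ((pochN 1 N)⁻¹ * (pochN 1 N)⁻¹) := by
  induction k with
  | zero => intro t h1 h2; omega
  | succ k ih =>
    intro t h1 h2 N
    have h := sum_inv_pochN N 0
    rw [add_zero] at h
    rw [boundedSum, boundedSum, ← h, Finset.mul_sum, Finset.mul_sum, ← Finset.sum_sub_distrib]
    refine Finset.sum_congr rfl fun n _ => ?_
    obtain rfl | ht := h1.eq_or_lt
    · rw [boundedSum_of_le_one k (by omega), boundedSum_of_le_one k (by omega), headExp, headExp,
        if_neg (by omega), if_pos le_rfl, inv_pochN_two, add_zero, add_zero,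
        ← one_sub_mul_inv_pochN_succ n]
      ring
    · have := ih (t := t - 1) (by omega) (by omega) n
      rw [Nat.sub_add_cancel h1] at this
      rw [headExp, headExp, if_neg (by omega), if_neg (by omega), Nat.add_sub_cancel,
        add_zero, zero_mul, add_zero, add_zero]
      linear_combination X ^ n ^ 2 * (pochN 1 (N - n))⁻¹ * this

theorem X_pow_dvd_pochN_sub {j : ℕ} (hj : j ≠ 0) (m l : ℕ) :
    X ^ (m + 1) ∣ pochN j (m + l) - pochN j m := by
  induction l with
  | zero => simp
  | succ l ih =>
    rw [← add_assoc, pochN_succ, mul_sub, mul_one, sub_right_comm]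
    exact dvd_sub ih (dvd_mul_of_dvd_right (pow_dvd_pow _ (by omega)) _)

/-- The extension of a finite sequence by zero. -/
def extendByZero {k : ℕ} (g : Fin k → ℕ) (j : ℕ) : ℕ :=
  if h : j < k then g ⟨j, h⟩ else 0

/-- The weakly decreasing sequences of length `k + 1` with first entry `n`. -/
def chains : (k n : ℕ) → Finset (Fin (k + 1) → ℕ)
  | 0, n => {fun _ => n}
  | k + 1, n => (Finset.range (n + 1)).biUnion fun m => (chains k m).image (Fin.cons n)

theorem mem_chains {k n : ℕ} {g : Fin (k + 1) → ℕ} :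
    g ∈ chains k n ↔ g 0 = n ∧ Antitone g := by
  induction k generalizing n with
  | zero =>
    rw [chains, Finset.mem_singleton]
    refine ⟨?_, fun h => funext fun i => by rw [← h.1, Fin.fin_one_eq_zero i]⟩
    rintro rfl
    exact ⟨rfl, antitone_const⟩
  | succ k ih =>
    simp only [chains, Finset.mem_biUnion, Finset.mem_range, Finset.mem_image, ih]
    constructor
    · rintro ⟨m, hm, h, ⟨h0, ha⟩, rfl⟩
      refine ⟨rfl, Fin.antitone_iff_succ_le.2 fun i => ?_⟩
      induction i using Fin.cases with
      | zero => simpa [h0] using Nat.lt_succ_iff.1 hm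
      | succ i =>
        rw [Fin.cons_succ, ← Fin.succ_castSucc, Fin.cons_succ]
        exact ha (Fin.castSucc_lt_succ).le
    · rintro ⟨h0, ha⟩
      refine ⟨g 1, ?_, Fin.tail g, ⟨rfl, fun i j hij => ha (Fin.succ_le_succ_iff.2 hij)⟩, ?_⟩
      · exact Nat.lt_succ_of_le (h0 ▸ ha (Fin.zero_le 1))
      · rw [← h0, Fin.cons_self_tail]

theorem sum_chains_succ {M : Type*} [AddCommMonoid M] (k n : ℕ) (F : (Fin (k + 2) → ℕ) → M) :
    ∑ g ∈ chains (k + 1) n, F g =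
      ∑ m ∈ Finset.range (n + 1), ∑ g ∈ chains k m, F (Fin.cons n g) := by
  rw [chains, Finset.sum_biUnion]
  · exact Finset.sum_congr rfl fun m _ =>
      Finset.sum_image (Fin.cons_right_injective (α := fun _ => ℕ) n).injOn
  · intro a _ b _ hab
    refine Finset.disjoint_left.2 fun g hga hgb => hab ?_
    obtain ⟨x, hx, rfl⟩ := Finset.mem_image.1 hga
    obtain ⟨y, hy, hxy⟩ := Finset.mem_image.1 hgb
    rw [← (mem_chains.1 hx).1, ← (mem_chains.1 hy).1,
      Fin.cons_right_injective (α := fun _ => ℕ) n hxy]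

theorem extendByZero_cons {k : ℕ} (n : ℕ) (g : Fin k → ℕ) (j : ℕ) :
    extendByZero (Fin.cons n g : Fin (k + 1) → ℕ) (j + 1) = extendByZero g j := by
  by_cases h : j < k
  · rw [extendByZero, extendByZero, dif_pos h, dif_pos (by omega)]
    exact Fin.cons_succ (α := fun _ => ℕ) n g ⟨j, h⟩
  · rw [extendByZero, extendByZero, dif_neg h, dif_neg (by omega)]

theorem extendByZero_zero {k n : ℕ} {g : Fin (k + 1) → ℕ} (hg : g ∈ chains k n) :
    extendByZero g 0 = n := by
  rw [extendByZero, dif_pos k.succ_pos]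
  exact (mem_chains.1 hg).1

theorem sum_chainTerm (k t N : ℕ) :
    ∑ g ∈ chains k N, chainTerm k t (extendByZero g) = boundedSum k t N := by
  induction k generalizing t N with
  | zero =>
    simp [chains, chainTerm, boundedSum, extendByZero, mul_comm]
  | succ k ih =>
    rw [sum_chains_succ, boundedSum]
    refine Finset.sum_congr rfl fun m _ => ?_
    rw [← ih, Finset.mul_sum]
    refine Finset.sum_congr rfl fun g hg => ?_
    rw [chainTerm_succ, extendByZero_cons, extendByZero_zero hg]
    simp only [extendByZero_cons]
    rfl

theorem Xser_succ (k t : ℕ) :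
    Xser (k + 1) t = ∑' f : {g : Fin (k + 1) → ℕ // ∀ i j : Fin (k + 1), i ≤ j → g j ≤ g i},
      X ^ headExp t (extendByZero f.1 0) * chainTerm k (t - 1) (extendByZero f.1) := by
  have h : ∀ j, (t ≤ j + 1 + 1) = (t - 1 ≤ j + 1) := fun j => by
    rw [eq_iff_iff]; omega
  refine tsum_congr fun f => ?_
  have key (c : ℕ → ℕ) : X ^ ((∑ j ∈ Finset.range (k + 1), (c j) ^ 2) +
        ∑ j ∈ Finset.range (k + 1), if t ≤ j + 1 then c j else 0) *
      ((∏ j ∈ Finset.range k, pochN 1 (c j - c (j + 1))) * pochN 1 (c k) * pochN 2 (c k))⁻¹ =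
      X ^ headExp t (c 0) * chainTerm k (t - 1) c := by
    simp only [chainTerm, headExp, Finset.sum_range_succ', pow_add, h, zero_add]
    ring
  exact key (extendByZero f.1)

theorem coeff_tsum_eq_sum {ι : Type*} (F : ι → PowerSeries ℚ) (s : ℕ → Finset ι)
    (hs : ∀ d, ∀ i ∉ s d, coeff d (F i) = 0) (d : ℕ) :
    coeff d (∑' i, F i) = ∑ i ∈ s d, coeff d (F i) := by
  have h : HasSum F (PowerSeries.mk fun d => ∑ i ∈ s d, coeff d (F i)) :=
    (WithPiTopology.hasSum_iff_hasSum_coeff ℚ).2 fun d => by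
      rw [coeff_mk]
      exact hasSum_sum_of_ne_finset_zero (hs d)
  have : T2Space (PowerSeries ℚ) := WithPiTopology.instT2Space ℚ
  rw [h.tsum_eq, coeff_mk]

theorem le_headExp (t n : ℕ) : n ≤ headExp t n :=
  le_add_right (Nat.le_self_pow two_ne_zero n)

theorem coeff_Xser_succ (k t d : ℕ) :
    coeff d (Xser (k + 1) t) = coeff d (∑ n ∈ Finset.range (d + 1),
      X ^ headExp t n * boundedSum k (t - 1) n) := by
  classical
  rw [Xser_succ, coeff_tsum_eq_sum _ fun d =>
    ((Finset.range (d + 1)).biUnion (chains k)).subtype _]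
  · rw [Finset.sum_subtype_of_mem (fun g => coeff d (X ^ headExp t (extendByZero g 0) *
      chainTerm k (t - 1) (extendByZero g))), Finset.sum_biUnion, map_sum]
    · refine Finset.sum_congr rfl fun n _ => ?_
      rw [← sum_chainTerm, Finset.mul_sum, map_sum]
      exact Finset.sum_congr rfl fun g hg => by rw [extendByZero_zero hg]
    · exact fun a _ b _ hab => Finset.disjoint_left.2 fun g hga hgb =>
        hab ((mem_chains.1 hga).1.symm.trans (mem_chains.1 hgb).1)
    · intro g hg
      obtain ⟨n, -, hn⟩ := Finset.mem_biUnion.1 hg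
      exact fun i j hij => (mem_chains.1 hn).2 hij
  · intro d f hf
    have hmem : f.1 ∈ chains k (f.1 0) := mem_chains.2 ⟨rfl, fun i j hij => f.2 i j hij⟩
    rw [coeff_X_pow_mul', if_neg]
    intro hle
    refine hf (Finset.mem_subtype.2 (Finset.mem_biUnion.2 ⟨f.1 0, Finset.mem_range.2 ?_, hmem⟩))
    rw [extendByZero_zero hmem] at hle
    exact Nat.lt_succ_of_le ((le_headExp t _).trans hle)

theorem X_pow_dvd_Xser_succ_sub_sum (k t D : ℕ) :
    X ^ (D + 1) ∣ Xser (k + 1) t - ∑ n ∈ Finset.range (D + 1),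
      X ^ headExp t n * boundedSum k (t - 1) n := by
  refine X_pow_dvd_iff.2 fun d hd => ?_
  rw [map_sub, coeff_Xser_succ, sub_eq_zero, map_sum, map_sum]
  refine Finset.sum_subset (Finset.range_mono (by omega)) fun n _ hn => ?_
  rw [coeff_X_pow_mul', if_neg]
  have := le_headExp t n
  rw [Finset.mem_range] at hn
  omega

theorem X_pow_dvd_Xser_sub {k : ℕ} (hk : 1 ≤ k) (t D : ℕ) :
    X ^ (D + 1) ∣ Xser k t - pochN 1 D * boundedSum k t D := by
  obtain ⟨k, rfl⟩ := Nat.exists_eq_add_of_le' hk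
  rw [← sub_add_sub_cancel]
  refine dvd_add (X_pow_dvd_Xser_succ_sub_sum k t D) ?_
  rw [boundedSum, Finset.mul_sum, ← Finset.sum_sub_distrib]
  refine Finset.dvd_sum fun n hn => ?_
  have hn' := Finset.mem_range.1 hn
  obtain ⟨u, hu⟩ := X_pow_dvd_pochN_sub one_ne_zero (D - n) n
  rw [Nat.sub_add_cancel (by omega)] at hu
  have h := pochN_mul_inv one_ne_zero (D - n)
  have hX : X ^ headExp t n * (pochN 1 D - pochN 1 (D - n)) =
      X ^ (headExp t n + (D - n + 1)) * u := by
    rw [hu, pow_add]; ring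
  refine (pow_dvd_pow X (by have := le_headExp t n; omega :
    D + 1 ≤ headExp t n + (D - n + 1))).trans
    ⟨-u * (pochN 1 (D - n))⁻¹ * boundedSum k (t - 1) n, ?_⟩
  linear_combination (-(pochN 1 (D - n))⁻¹ * boundedSum k (t - 1) n) * hX
    - X ^ headExp t n * boundedSum k (t - 1) n * h

theorem X_pow_dvd_tprod_sub (D : ℕ) :
    X ^ (D + 1) ∣ (∏' s : ℕ, (1 - (X : PowerSeries ℚ) ^ (s + 2))) - pochN 2 D := by
  have : T2Space (PowerSeries ℚ) := WithPiTopology.instT2Space ℚ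
  have hm : Multipliable fun s : ℕ => 1 - (X : PowerSeries ℚ) ^ (s + 2) := by
    simp_rw [sub_eq_add_neg]
    refine WithPiTopology.multipliable_one_add_of_tendsto_order_atTop_nhds_top ℚ
      (ENat.tendsto_nhds_top_iff_natCast_lt.2 fun n => Filter.eventually_atTop.2 ⟨n, ?_⟩)
    intro m hm
    rw [order_neg, order_X_pow]
    norm_cast
    omega
  have ht := hm.hasProd.tendsto_prod_nat
  refine X_pow_dvd_iff.2 fun d hd => ?_
  rw [map_sub, sub_eq_zero]
  refine tendsto_nhds_unique
    ((WithPiTopology.tendsto_iff_coeff_tendsto _ _ _ _).1 ht d) ?_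
  refine tendsto_const_nhds.congr' (Filter.eventually_atTop.2 ⟨D, fun n hn => ?_⟩)
  obtain ⟨l, rfl⟩ := Nat.exists_eq_add_of_le hn
  have h := X_pow_dvd_iff.1 (X_pow_dvd_pochN_sub two_ne_zero D l) d hd
  rw [map_sub, sub_eq_zero] at h
  rw [← h, pochN]
  simp only [add_comm 2]

theorem eq_of_forall_X_pow_dvd_sub {f g : PowerSeries ℚ} (h : ∀ D : ℕ, X ^ (D + 1) ∣ f - g) :
    f = g :=
  PowerSeries.ext fun d => sub_eq_zero.1 (by
    rw [← map_sub]; exact X_pow_dvd_iff.1 (h d) d d.lt_succ_self)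

theorem X_pow_dvd_Xser_one_sub {k : ℕ} (hk : 1 ≤ k) (D : ℕ) :
    X ^ (D + 1) ∣ Xser k 1 - (pochN 2 D)⁻¹ := by
  have h := X_pow_dvd_Xser_sub hk 1 D
  rwa [boundedSum_of_le_one k le_rfl, ← mul_assoc, pochN_mul_inv one_ne_zero, one_mul] at h

theorem Xser_one {k : ℕ} (hk : 1 ≤ k) :
    Xser k 1 = (∏' s : ℕ, (1 - (X : PowerSeries ℚ) ^ (s + 2)))⁻¹ := by
  have hP : constantCoeff (∏' s : ℕ, (1 - (X : PowerSeries ℚ) ^ (s + 2))) ≠ 0 := by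
    have h := X_pow_dvd_iff.1 (X_pow_dvd_tprod_sub 0) 0 one_pos
    rw [map_sub, sub_eq_zero, coeff_zero_eq_constantCoeff_apply,
      coeff_zero_eq_constantCoeff_apply, constantCoeff_pochN two_ne_zero] at h
    rw [h]
    exact one_ne_zero
  rw [PowerSeries.eq_inv_iff_mul_eq_one hP]
  refine eq_of_forall_X_pow_dvd_sub fun D => ?_
  obtain ⟨u, hu⟩ := X_pow_dvd_Xser_one_sub hk D
  obtain ⟨v, hv⟩ := X_pow_dvd_tprod_sub D
  have h := pochN_mul_inv two_ne_zero D
  refine ⟨u * (∏' s : ℕ, (1 - (X : PowerSeries ℚ) ^ (s + 2))) + (pochN 2 D)⁻¹ * v, ?_⟩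
  linear_combination (∏' s : ℕ, (1 - (X : PowerSeries ℚ) ^ (s + 2))) * hu +
    (pochN 2 D)⁻¹ * hv + h

theorem Xser_one_eq_sub {k t : ℕ} (ht : 1 ≤ t) (htk : t ≤ k) :
    Xser k 1 = Xser k (t + 1) - X * Xser k t := by
  have hk := ht.trans htk
  refine eq_of_forall_X_pow_dvd_sub fun D => ?_
  obtain ⟨u, hu⟩ := X_pow_dvd_Xser_one_sub hk D
  obtain ⟨v, hv⟩ := X_pow_dvd_Xser_sub hk (t + 1) D
  obtain ⟨w, hw⟩ := X_pow_dvd_Xser_sub hk t D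
  have h := boundedSum_succ_sub k ht htk D
  have hD := pochN_mul_inv one_ne_zero D
  have hs := one_sub_mul_inv_pochN_succ D
  rw [inv_pochN_two] at hu
  refine ⟨u - v + X * w + (1 - X) * (pochN 1 (D + 1))⁻¹, ?_⟩
  linear_combination hu - hv + X * hw - pochN 1 D * h + (1 - X) * hs
    - (1 - X) * (pochN 1 D)⁻¹ * hD

/-- Corollary `cor:initcond`: for `k ≥ 1` and `1 ≤ t ≤ k`,
`X(k,1) = X(k,t+1) − q·X(k,t) = 1/(q²;q)_∞`. -/
theorem statement5 (k : ℕ) (hk : 1 ≤ k) :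
    ∀ t : ℕ, 1 ≤ t → t ≤ k →
      Xser k 1 = Xser k (t + 1) - (X : PowerSeries ℚ) * Xser k t ∧
      Xser k 1 = (∏' s : ℕ, (1 - (X : PowerSeries ℚ) ^ (s + 2)))⁻¹ := by
  exact fun t ht htk => ⟨Xser_one_eq_sub ht htk, Xser_one hk⟩
end
end
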